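/- (Multidimensional Komlós) Let ℙ_1,…,ℙ_N be probability measures absolutely continuous with respect to ℙ, and let (Y_n)_n ⊆ L¹(ℙ_1) × … × L¹(ℙ_N) satisfy sup_n ∑_{j=1}^N E_ℙ[|Y_n^j| dℙ_j/dℙ] < ∞. Then there exist a subsequence (Y_{n_h})_h and Ŷ ∈ L¹(ℙ_1) × … × L¹(ℙ_N) such that every further subsequence (Y_{n_{h_k}})_k satisfies (1/K)∑_{k=1}^K Y_{n_{h_k}}^j → Ŷ^j ℙ_j-a.s. as K → ∞, for every j = 1,…,N. -/

import Mathlib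

open MeasureTheory Filter
open scoped BigOperators ENNReal Classical

noncomputable section

namespace MSORTE

variable {Ω : Type*} [MeasurableSpace Ω]

/-- inner product on `ℝ^N` -/
def dot {N : ℕ} (x y : Fin N → ℝ) : ℝ := ∑ j, x j * y j

/-- convex conjugate `V(y) = sup_x (U(x) - ⟨x,y⟩)` -/
def conj {N : ℕ} (U : (Fin N → ℝ) → ℝ) (y : Fin N → ℝ) : ℝ :=
  sSup {r | ∃ x : Fin N → ℝ, r = U x - dot x y}

/-- componentwise negative part -/
def negPart {N : ℕ} (x : Fin N → ℝ) : Fin N → ℝ := fun j => max (-(x j)) 0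

/-- componentwise positive part -/
def posPart {N : ℕ} (x : Fin N → ℝ) : Fin N → ℝ := fun j => max (x j) 0

/-- multivariate utility function: strictly concave, strictly increasing componentwise -/
def MultiUtility {N : ℕ} (U : (Fin N → ℝ) → ℝ) : Prop :=
  StrictConcaveOn ℝ Set.univ U ∧ ∀ x y : Fin N → ℝ, x ≤ y → x ≠ y → U x < U y

/-- multivariate Orlicz function -/
def MultiOrlicz {N : ℕ} (Φ : (Fin N → ℝ) → ℝ) : Prop :=
  Φ 0 = 0 ∧ ConvexOn ℝ {x : Fin N → ℝ | 0 ≤ x} Φ ∧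
  ContinuousOn Φ {x : Fin N → ℝ | 0 ≤ x} ∧
  (∀ x y : Fin N → ℝ, 0 ≤ x → x ≤ y → Φ x ≤ Φ y) ∧
  ∃ A > (0:ℝ), ∃ B : ℝ, ∀ x : Fin N → ℝ, 0 ≤ x → A * (∑ j, x j) - B ≤ Φ x

/-- the Orlicz function associated to a multivariate utility: `Φ(x) = U(0) - U(-x)` -/
def UPhi {N : ℕ} (U : (Fin N → ℝ) → ℝ) : (Fin N → ℝ) → ℝ := fun x => U 0 - U (-x)

/-- `U` is well controlled by the multivariate Orlicz function `Φhat` and the function `f` -/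
def WellControlledBy {N : ℕ} (U Φhat : (Fin N → ℝ) → ℝ) (f : ℝ → ℝ) : Prop :=
  MultiOrlicz Φhat ∧
  ∀ ε > (0:ℝ), ∀ x : Fin N → ℝ,
    U x ≤ -Φhat (negPart x) + ε * (∑ j, |x j|) + f ε

/-- the multivariate Orlicz space `L^Φ` -/
def Lspace {N : ℕ} (ℙ : Measure Ω) (Φ : (Fin N → ℝ) → ℝ) : Set (Ω → Fin N → ℝ) :=
  {X | Measurable X ∧ ∃ lam > (0:ℝ), Integrable (fun ω => Φ (fun j => lam * |X ω j|)) ℙ}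

/-- the multivariate Orlicz heart `M^Φ` -/
def Mspace {N : ℕ} (ℙ : Measure Ω) (Φ : (Fin N → ℝ) → ℝ) : Set (Ω → Fin N → ℝ) :=
  {X | Measurable X ∧ ∀ lam > (0:ℝ), Integrable (fun ω => Φ (fun j => lam * |X ω j|)) ℙ}

/-- the Köthe dual `K_Φ` of `L^Φ` -/
def Kdual {N : ℕ} (ℙ : Measure Ω) (Φ : (Fin N → ℝ) → ℝ) : Set (Ω → Fin N → ℝ) :=
  {Z | Measurable Z ∧ ∀ X ∈ Lspace ℙ Φ, Integrable (fun ω => ∑ j, X ω j * Z ω j) ℙ}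

/-- `C_ℝ`: random vectors whose componentwise sum is a.s. a real constant -/
def CReal {N : ℕ} (ℙ : Measure Ω) : Set (Ω → Fin N → ℝ) :=
  {Y | Measurable Y ∧ ∃ c : ℝ, ∀ᵐ ω ∂ℙ, (∑ j, Y ω j) = c}

/-- Standing Assumption II on the feasible set `𝓑` (except `X ∈ M^Φ`) -/
structure IsFeasibleSet {N : ℕ} (ℙ : Measure Ω) (B : Set (Ω → Fin N → ℝ)) : Prop where
  subset_CReal : B ⊆ CReal ℙ
  zero_mem : (0 : Ω → Fin N → ℝ) ∈ B
  add_mem : ∀ Y ∈ B, ∀ Z ∈ B, Y + Z ∈ B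
  smul_mem : ∀ Y ∈ B, ∀ c : ℝ, 0 ≤ c → c • Y ∈ B
  closed_in_probability : ∀ (Ys : ℕ → Ω → Fin N → ℝ) (Y : Ω → Fin N → ℝ),
    (∀ n, Ys n ∈ B) → Measurable Y → TendstoInMeasure ℙ Ys atTop Y → Y ∈ B
  const_add_mem : ∀ Y ∈ B, ∀ a : Fin N → ℝ, (fun ω => a + Y ω) ∈ B

/-- `𝓑_A` -/
def BA {N : ℕ} (ℙ : Measure Ω) (B : Set (Ω → Fin N → ℝ)) (A : ℝ) : Set (Ω → Fin N → ℝ) :=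
  {Y | Y ∈ B ∧ ∀ᵐ ω ∂ℙ, (∑ j, Y ω j) ≤ A}

/-- vector of Radon-Nikodym densities of a vector of measures w.r.t. `ℙ` -/
def dens {N : ℕ} (ℙ : Measure Ω) (Q : Fin N → Measure Ω) : Ω → Fin N → ℝ :=
  fun ω j => ((Q j).rnDeriv ℙ ω).toReal

/-- the set `𝓠` of admissible vectors of probability measures -/
def QSet {N : ℕ} (ℙ : Measure Ω) (B : Set (Ω → Fin N → ℝ)) (Φ : (Fin N → ℝ) → ℝ) :
    Set (Fin N → Measure Ω) :=
  {Q | (∀ j, IsProbabilityMeasure (Q j)) ∧ (∀ j, Q j ≪ ℙ) ∧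
    dens ℙ Q ∈ Kdual ℙ Φ ∧
    ∀ Y ∈ BA ℙ B 0 ∩ Mspace ℙ Φ, (∑ j, ∫ ω, Y ω j ∂(Q j)) ≤ 0}

/-- the set `𝓠_{𝓑,V}` of vectors of probability measures with finite entropy -/
def QBV {N : ℕ} (ℙ : Measure Ω) (B : Set (Ω → Fin N → ℝ))
    (Φ V : (Fin N → ℝ) → ℝ) : Set (Fin N → Measure Ω) :=
  {Q | Q ∈ QSet ℙ B Φ ∧ ∃ lam > (0:ℝ),
    Integrable (fun ω => V (fun j => lam * dens ℙ Q ω j)) ℙ}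

/-- the set `𝓛 = ⋂_{Q ∈ 𝓠_{𝓑,V}} L¹(Q)` -/
def LSet {N : ℕ} (ℙ : Measure Ω) (B : Set (Ω → Fin N → ℝ))
    (Φ V : (Fin N → ℝ) → ℝ) : Set (Ω → Fin N → ℝ) :=
  {Y | Measurable Y ∧ ∀ Q ∈ QBV ℙ B Φ V, ∀ j, Integrable (fun ω => Y ω j) (Q j)}

/-- Assumption A1: `𝓑` is closed under truncation -/
def ClosedUnderTruncation {N : ℕ} (ℙ : Measure Ω) (B : Set (Ω → Fin N → ℝ)) : Prop :=
  ∀ Y ∈ B, ∃ (mY : ℕ) (cY : Fin N → ℝ),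
    (∀ᵐ ω ∂ℙ, (∑ j, Y ω j) = ∑ j, cY j) ∧
    ∀ m : ℕ, mY ≤ m →
      (fun ω => if ∀ j, |Y ω j| < (m:ℝ) then Y ω else cY) ∈ B

/-- expected utility `E_ℙ[U(W)]` -/
def expU {N : ℕ} (ℙ : Measure Ω) (U : (Fin N → ℝ) → ℝ) (W : Ω → Fin N → ℝ) : ℝ :=
  ∫ ω, U (W ω) ∂ℙ

/-- the dual objective `λ(∑ⱼ E_{Qʲ}[Xʲ] + A) + E_ℙ[V(λ dQ/dℙ)]` -/
def dualVal {N : ℕ} (ℙ : Measure Ω) (V : (Fin N → ℝ) → ℝ) (X : Ω → Fin N → ℝ)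
    (A : ℝ) (Q : Fin N → Measure Ω) (lam : ℝ) : ℝ :=
  lam * ((∑ j, ∫ ω, X ω j ∂(Q j)) + A) + ∫ ω, V (fun j => lam * dens ℙ Q ω j) ∂ℙ

/-- `(L^∞(ℙ))^N` -/
def Linfty {N : ℕ} (ℙ : Measure Ω) : Set (Ω → Fin N → ℝ) :=
  {Y | Measurable Y ∧ ∃ C : ℝ, ∀ᵐ ω ∂ℙ, ∀ j, |Y ω j| ≤ C}

/-- multivariate Systemic Optimal Risk Transfer Equilibrium with budget `A` -/
def IsMSORTE {N : ℕ} (ℙ : Measure Ω) (B : Set (Ω → Fin N → ℝ))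
    (U : (Fin N → ℝ) → ℝ) (X : Ω → Fin N → ℝ) (A : ℝ)
    (Y : Ω → Fin N → ℝ) (Q : Fin N → Measure Ω) (a : Fin N → ℝ) : Prop :=
  Y ∈ LSet ℙ B (UPhi U) (conj U) ∧ Q ∈ QBV ℙ B (UPhi U) (conj U) ∧
  (∑ j, a j) = A ∧
  (∀ Y' ∈ LSet ℙ B (UPhi U) (conj U), ∀ a' : Fin N → ℝ, (∑ j, a' j) = A →
    expU ℙ U (fun ω j => a' j + X ω j + Y' ω j - ∫ ω', Y' ω' j ∂(Q j)) ≤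
    expU ℙ U (fun ω j => a j + X ω j + Y ω j - ∫ ω', Y ω' j ∂(Q j))) ∧
  Y ∈ B ∧ (∀ᵐ ω ∂ℙ, (∑ j, Y ω j) = 0)

section Komlos

open ProbabilityTheory
open scoped Topology InnerProductSpace

theorem exists_subseq_tendsto_of_bounded {ι : Type*} [Countable ι] (x : ℕ → ι → ℝ) (C : ι → ℝ)
    (h : ∀ n i, |x n i| ≤ C i) :
    ∃ φ : ℕ → ℕ, StrictMono φ ∧ ∃ l : ι → ℝ, ∀ i, Tendsto (fun n => x (φ n) i) atTop (𝓝 (l i)) := by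
  have hc : IsCompact (Set.pi Set.univ fun i => Set.Icc (-C i) (C i)) :=
    isCompact_univ_pi fun i => isCompact_Icc
  obtain ⟨l, -, φ, hφ, hl⟩ := hc.tendsto_subseq (x := x) fun n i _ => abs_le.1 (h n i)
  exact ⟨φ, hφ, l, fun i => (tendsto_pi_nhds.1 hl i)⟩

theorem exists_strictMono_of_eventually {R : ℕ → ℕ → Prop} (h : ∀ p, ∀ᶠ n in atTop, R p n) :
    ∃ φ : ℕ → ℕ, StrictMono φ ∧ ∀ m, ∃ p, m ≤ p ∧ R p (φ m) ∧ ∀ i < m, φ i ≤ p := by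
  obtain ⟨f, -, hf⟩ := exists_seq_of_forall_finset_exists (fun _ : ℕ => True)
    (fun p n => p < n ∧ R p n) fun s _ => by
      have := (eventually_all_finset s).2 fun p _ => (eventually_gt_atTop p).and (h p)
      obtain ⟨y, hy⟩ := this.exists
      exact ⟨y, trivial, hy⟩
  have hmono : StrictMono f := fun a b hab => (hf a b hab).1
  refine ⟨fun m => f (m + 1), fun a b hab => hmono (by simpa using hab), fun m =>
    ⟨f m, hmono.id_le m, (hf m (m + 1) m.lt_succ_self).2, fun i hi => hmono.monotone hi⟩⟩

theorem exists_weak_limit {E : Type*} [NormedAddCommGroup E] [InnerProductSpace ℝ E]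
    [CompleteSpace E] (u : ℕ → E) (C : ℝ) (hC : ∀ n, ‖u n‖ ≤ C)
    (h : ∀ m, ∃ l, Tendsto (fun n => ⟪u n, u m⟫_ℝ) atTop (𝓝 l)) :
    ∃ g : E, ∀ v, Tendsto (fun n => ⟪u n, v⟫_ℝ) atTop (𝓝 ⟪g, v⟫_ℝ) := by
  let V : Submodule ℝ E :=
    { carrier := {v | CauchySeq fun n => ⟪u n, v⟫_ℝ}
      add_mem' := fun {a b} ha hb => by
        simp only [Set.mem_ofPred_eq, inner_add_right]
        exact ha.add hb
      zero_mem' := by simpa using cauchySeq_const (0 : ℝ)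
      smul_mem' := fun c a ha => by
        simp only [Set.mem_ofPred_eq, inner_smul_right]
        exact (uniformContinuous_const_smul c).comp_cauchySeq ha }
  have hVclosed : IsClosed (V : Set E) := by
    refine isClosed_of_closure_subset fun v hv => ?_
    change CauchySeq fun n => ⟪u n, v⟫_ℝ
    have hC0 : 0 ≤ C := (norm_nonneg _).trans (hC 0)
    rw [Metric.cauchySeq_iff']
    intro ε hε
    obtain ⟨w, hw, hvw⟩ := Metric.mem_closure_iff.1 hv (ε / (4 * (C + 1))) (by positivity)
    have hw' : CauchySeq fun n => ⟪u n, w⟫_ℝ := hw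
    obtain ⟨N, hN⟩ := Metric.cauchySeq_iff'.1 hw' (ε / 2) (by positivity)
    refine ⟨N, fun n hn => ?_⟩
    have key : ∀ n, |⟪u n, v⟫_ℝ - ⟪u n, w⟫_ℝ| ≤ ε / 4 := fun n => by
      rw [← inner_sub_right]
      refine (abs_real_inner_le_norm _ _).trans ?_
      rw [dist_eq_norm] at hvw
      calc ‖u n‖ * ‖v - w‖ ≤ (C + 1) * (ε / (4 * (C + 1))) := by
            gcongr
            linarith [hC n]
        _ = ε / 4 := by field_simp
    have h1 := key n
    have h2 := key N
    have h3 := hN n hn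
    rw [Real.dist_eq] at h3 ⊢
    rw [abs_le] at h1 h2
    rw [abs_lt] at h3 ⊢
    constructor <;> linarith
  have hV : V = ⊤ := by
    have : CompleteSpace V := hVclosed.completeSpace_coe
    rw [← Submodule.orthogonal_eq_bot_iff, Submodule.eq_bot_iff]
    intro v hv
    have huV : ∀ m, u m ∈ V := fun m => (h m).choose_spec.cauchySeq
    have hvV : v ∈ V := by
      change CauchySeq fun n => ⟪u n, v⟫_ℝ
      have : (fun n => ⟪u n, v⟫_ℝ) = fun _ => 0 := funext fun n => hv _ (huV n)
      rw [this]
      exact cauchySeq_const 0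
    exact inner_self_eq_zero.1 (hv v hvV)
  have hlim : ∀ v, ∃ l, Tendsto (fun n => ⟪u n, v⟫_ℝ) atTop (𝓝 l) := fun v =>
    cauchySeq_tendsto_of_complete (show v ∈ V from hV ▸ Submodule.mem_top)
  choose L hL using hlim
  let ℓ : E →ₗ[ℝ] ℝ :=
    { toFun := L
      map_add' := fun a b => tendsto_nhds_unique (hL _)
        (by simpa only [inner_add_right] using (hL a).add (hL b))
      map_smul' := fun c a => tendsto_nhds_unique (hL _)
        (by simpa only [inner_smul_right, RingHom.id_apply, smul_eq_mul] using (hL a).const_mul c) }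
  have hbound : ∀ v, ‖ℓ v‖ ≤ C * ‖v‖ := fun v =>
    le_of_tendsto (hL v).norm (.of_forall fun n => (norm_inner_le_norm _ _).trans (by
      gcongr; exact hC n))
  refine ⟨(InnerProductSpace.toDual ℝ E).symm (ℓ.mkContinuous C hbound), fun v => ?_⟩
  rw [InnerProductSpace.toDual_symm_apply]
  exact hL v

theorem norm_sum_sq_le {E : Type*} [NormedAddCommGroup E] [InnerProductSpace ℝ E]
    (x : ℕ → E) (W : ℕ → ℝ)
    (hW : ∀ k, ‖x k‖ ^ 2 + 2 * ∑ j ∈ Finset.range k, ⟪x j, x k⟫_ℝ ≤ W k) (K : ℕ) :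
    ‖∑ k ∈ Finset.range K, x k‖ ^ 2 ≤ ∑ k ∈ Finset.range K, W k := by
  induction K with
  | zero => simp
  | succ K ih =>
    rw [Finset.sum_range_succ, Finset.sum_range_succ, norm_add_sq_real, sum_inner]
    linarith [hW K]

theorem summable_norm_sq_average_floor_pow {E : Type*} [NormedAddCommGroup E] [NormedSpace ℝ E]
    (x : ℕ → E) (W : ℕ → ℝ) (hW0 : W 0 = 0) (hW : ∀ k, 0 ≤ W k)
    (hsum : Summable fun k : ℕ => W k / (k : ℝ) ^ 2)
    (hx : ∀ K, ‖∑ k ∈ Finset.range K, x k‖ ^ 2 ≤ ∑ k ∈ Finset.range K, W k)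
    {c : ℝ} (hc : 1 < c) :
    Summable fun i : ℕ => ‖((⌊c ^ i⌋₊ : ℝ)⁻¹) • ∑ k ∈ Finset.range ⌊c ^ i⌋₊, x k‖ ^ 2 := by
  set D : ℝ := c ^ 5 * (c - 1)⁻¹ ^ 3 with hD
  refine summable_of_sum_range_le (c := D * ∑' k : ℕ, W k / (k : ℝ) ^ 2)
    (fun _ => by positivity) fun N => ?_
  obtain ⟨T, hT⟩ : ∃ T, ∀ i ∈ Finset.range N, ⌊c ^ i⌋₊ ≤ T :=
    ⟨∑ i ∈ Finset.range N, ⌊c ^ i⌋₊, fun i hi =>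
      Finset.single_le_sum (f := fun i => ⌊c ^ i⌋₊) (fun _ _ => Nat.zero_le _) hi⟩
  have hfilter : ∀ i ∈ Finset.range N, ∑ k ∈ Finset.range ⌊c ^ i⌋₊, W k =
      ∑ k ∈ Finset.range T with k < ⌊c ^ i⌋₊, W k := fun i hi => by
    congr 1
    ext k
    simp only [Finset.mem_range, Finset.mem_filter]
    have := hT i hi
    omega
  calc ∑ i ∈ Finset.range N, ‖((⌊c ^ i⌋₊ : ℝ)⁻¹) • ∑ k ∈ Finset.range ⌊c ^ i⌋₊, x k‖ ^ 2
      ≤ ∑ i ∈ Finset.range N, ∑ k ∈ Finset.range T with k < ⌊c ^ i⌋₊,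
          1 / (⌊c ^ i⌋₊ : ℝ) ^ 2 * W k := by
        refine Finset.sum_le_sum fun i hi => ?_
        rw [← Finset.mul_sum, ← hfilter i hi, norm_smul, mul_pow, norm_inv, inv_pow, one_div,
          Real.norm_natCast]
        gcongr
        exact hx _
    _ = ∑ k ∈ Finset.range T, W k * ∑ i ∈ Finset.range N with k < ⌊c ^ i⌋₊,
          1 / (⌊c ^ i⌋₊ : ℝ) ^ 2 := by
        simp_rw [Finset.sum_filter, Finset.mul_sum]
        rw [Finset.sum_comm]
        refine Finset.sum_congr rfl fun k _ => Finset.sum_congr rfl fun i _ => ?_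
        split_ifs <;> ring
    _ ≤ ∑ k ∈ Finset.range T, D * (W k / (k : ℝ) ^ 2) := by
        refine Finset.sum_le_sum fun k _ => ?_
        rcases Nat.eq_zero_or_pos k with rfl | hk
        · simp [hW0]
        · have := sum_div_nat_floor_pow_sq_le_div_sq N (j := (k : ℝ)) (by exact_mod_cast hk) hc
          simp only [Nat.cast_lt] at this
          calc _ ≤ W k * (D / (k : ℝ) ^ 2) := mul_le_mul_of_nonneg_left this (hW k)
            _ = _ := by ring
    _ ≤ D * ∑' k : ℕ, W k / (k : ℝ) ^ 2 := by
        rw [← Finset.mul_sum]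
        have : 0 < c - 1 := by linarith
        gcongr
        exact hsum.sum_le_tsum _ fun k _ => div_nonneg (hW k) (by positivity)

theorem ae_tendsto_zero_of_summable_norm_sq {Ω : Type*} [MeasurableSpace Ω] {μ : Measure Ω}
    (x : ℕ → Lp ℝ 2 μ) (hx : Summable fun i => ‖x i‖ ^ 2) :
    ∀ᵐ ω ∂μ, Tendsto (fun i => x i ω) atTop (𝓝 0) := by
  have hlint : ∀ i, ∫⁻ ω, ‖x i ω‖ₑ ^ 2 ∂μ = ENNReal.ofReal (‖x i‖ ^ 2) := fun i => by
    rw [ENNReal.ofReal_pow (norm_nonneg _), ofReal_norm, Lp.enorm_def,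
      eLpNorm_eq_lintegral_rpow_enorm_toReal (by simp) (by simp)]
    simp only [ENNReal.toReal_ofNat, ENNReal.rpow_ofNat, one_div]
    rw [← ENNReal.rpow_natCast, ← ENNReal.rpow_mul]
    simp
  have hmeas : ∀ i, AEMeasurable (fun ω => ‖x i ω‖ₑ ^ 2) μ := fun i =>
    (Lp.aestronglyMeasurable (x i)).enorm.pow_const 2
  have hfin : ∫⁻ ω, ∑' i, ‖x i ω‖ₑ ^ 2 ∂μ ≠ ⊤ := by
    rw [lintegral_tsum hmeas]
    simp_rw [hlint]
    exact hx.tsum_ofReal_ne_top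
  filter_upwards [ae_lt_top' (AEMeasurable.tsum hmeas) hfin] with ω hω
  have h0 := ENNReal.tendsto_atTop_zero_of_tsum_ne_top hω.ne
  have h1 : Tendsto (fun i => (‖x i ω‖ₑ ^ 2).toReal) atTop (𝓝 0) := by
    exact (ENNReal.tendsto_toReal ENNReal.zero_ne_top).comp h0
  simp only [ENNReal.toReal_pow, toReal_enorm] at h1
  have h2 := h1.sqrt
  simp only [norm_nonneg, Real.sqrt_sq, Real.sqrt_zero] at h2
  exact tendsto_zero_iff_norm_tendsto_zero.2 h2

theorem exists_subseq_almost_orthogonal {E : Type*} [NormedAddCommGroup E]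
    [InnerProductSpace ℝ E] [CompleteSpace E] (u : ℕ → ℕ → E) (C : ℕ → ℝ)
    (hC : ∀ k n, ‖u k n‖ ≤ C k) (b : ℕ → ℕ → ℝ) (hb : ∀ k n, |b k n| ≤ 1) :
    ∃ (φ : ℕ → ℕ) (A B : ℕ → ℝ) (g : ℕ → E), StrictMono φ ∧
      (∀ k v, Tendsto (fun n => ⟪u k (φ n), v⟫_ℝ) atTop (𝓝 ⟪g k, v⟫_ℝ)) ∧
      (∀ k, Tendsto (fun n => ‖u k (φ n)‖ ^ 2) atTop (𝓝 (A k))) ∧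
      (∀ k, Tendsto (fun n => b k (φ n)) atTop (𝓝 (B k))) ∧
      ∀ ψ : ℕ → ℕ, StrictMono ψ → ∀ k,
        ‖u k (φ (ψ k)) - g k‖ ^ 2 ≤ A k + 1 ∧ b k (φ (ψ k)) ≤ B k + (1 / 2) ^ k ∧
        ∀ j < k, ⟪u j (φ (ψ j)) - g j, u k (φ (ψ k)) - g k⟫_ℝ ≤ 1 / ((k : ℝ) + 1) := by
  have hC0 : ∀ k, 0 ≤ C k := fun k => (norm_nonneg _).trans (hC k 0)
  obtain ⟨φ₀, hφ₀, l, hl⟩ := exists_subseq_tendsto_of_bounded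
    (fun n => Sum.elim (fun p : ℕ × ℕ => ⟪u p.1 n, u p.1 p.2⟫_ℝ)
      (Sum.elim (fun k => ‖u k n‖ ^ 2) (fun k => b k n)))
    (Sum.elim (fun p => C p.1 * C p.1) (Sum.elim (fun k => C k ^ 2) fun _ => 1))
    (by
      rintro n (⟨k, m⟩ | k | k)
      · exact (abs_real_inner_le_norm _ _).trans
          (mul_le_mul (hC k n) (hC k m) (norm_nonneg _) (hC0 k))
      · simp only [Sum.elim_inr, Sum.elim_inl, abs_pow, abs_norm]
        gcongr
        exact hC k n
      · exact hb k n)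
  have hweak : ∀ k, ∃ g : E, ∀ v, Tendsto (fun n => ⟪u k (φ₀ n), v⟫_ℝ) atTop (𝓝 ⟪g, v⟫_ℝ) :=
    fun k => exists_weak_limit (fun n => u k (φ₀ n)) (C k) (fun n => hC k _)
      fun m => ⟨_, hl (Sum.inl (k, φ₀ m))⟩
  choose g hg using hweak
  let A : ℕ → ℝ := fun k => l (Sum.inr (Sum.inl k))
  let B : ℕ → ℝ := fun k => l (Sum.inr (Sum.inr k))
  have hA : ∀ k, Tendsto (fun n => ‖u k (φ₀ n)‖ ^ 2) atTop (𝓝 (A k)) :=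
    fun k => hl (Sum.inr (Sum.inl k))
  have hB : ∀ k, Tendsto (fun n => b k (φ₀ n)) atTop (𝓝 (B k)) :=
    fun k => hl (Sum.inr (Sum.inr k))
  have hAev : ∀ k, ∀ᶠ n in atTop, ‖u k (φ₀ n) - g k‖ ^ 2 ≤ A k + 1 := fun k => by
    have : Tendsto (fun n => ‖u k (φ₀ n) - g k‖ ^ 2) atTop
        (𝓝 (A k - 2 * ⟪g k, g k⟫_ℝ + ‖g k‖ ^ 2)) := by
      simp_rw [norm_sub_sq_real]
      exact ((hA k).sub ((hg k (g k)).const_mul 2)).add_const _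
    refine this.eventually_le_const ?_
    rw [real_inner_self_eq_norm_sq]
    nlinarith [sq_nonneg ‖g k‖]
  have hBev : ∀ k, ∀ᶠ n in atTop, b k (φ₀ n) ≤ B k + (1 / 2) ^ k := fun k =>
    (hB k).eventually_le_const (lt_add_of_pos_right _ (by positivity))
  have hOrth : ∀ p q j k : ℕ, ∀ᶠ n in atTop,
      ⟪u j (φ₀ q) - g j, u k (φ₀ n) - g k⟫_ℝ ≤ 1 / ((p : ℝ) + 1) := fun p q j k => by
    have : Tendsto (fun n => ⟪u j (φ₀ q) - g j, u k (φ₀ n) - g k⟫_ℝ) atTop (𝓝 0) := by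
      simp_rw [real_inner_comm (u k (φ₀ _) - g k), inner_sub_left]
      simpa using (hg k (u j (φ₀ q) - g j)).sub_const ⟪g k, u j (φ₀ q) - g j⟫_ℝ
    exact this.eventually_le_const (by positivity)
  obtain ⟨φ₁, hφ₁, hsel⟩ := exists_strictMono_of_eventually
    (R := fun p n => ∀ k ∈ Finset.range (p + 1), ‖u k (φ₀ n) - g k‖ ^ 2 ≤ A k + 1 ∧
      b k (φ₀ n) ≤ B k + (1 / 2) ^ k ∧ ∀ j ∈ Finset.range (p + 1), ∀ q ∈ Finset.range (p + 1),
        ⟪u j (φ₀ q) - g j, u k (φ₀ n) - g k⟫_ℝ ≤ 1 / ((p : ℝ) + 1))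
    fun p => (eventually_all_finset _).2 fun k _ => (hAev k).and ((hBev k).and
      ((eventually_all_finset _).2 fun j _ => (eventually_all_finset _).2 fun q _ =>
        hOrth p q j k))
  have hφ₁' := hφ₁.tendsto_atTop
  refine ⟨φ₀ ∘ φ₁, A, B, g, hφ₀.comp hφ₁, fun k v => (hg k v).comp hφ₁',
    fun k => (hA k).comp hφ₁', fun k => (hB k).comp hφ₁', fun ψ hψ k => ?_⟩
  obtain ⟨p, hp, hR, hlt⟩ := hsel (ψ k)
  have hkp : k ≤ p := (hψ.id_le k).trans hp
  obtain ⟨h1, h2, h3⟩ := hR k (Finset.mem_range_succ_iff.2 hkp)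
  refine ⟨h1, h2, fun j hj => (h3 j (Finset.mem_range_succ_iff.2 (hj.le.trans hkp)) _
    (Finset.mem_range_succ_iff.2 (hlt _ (hψ hj)))).trans ?_⟩
  gcongr

theorem exists_integrable_limit_of_monotone {Ω : Type*} [MeasurableSpace Ω] {μ : Measure Ω}
    (g : ℕ → Ω → ℝ) (hmeas : ∀ k, Measurable (g k)) (hint : ∀ k, Integrable (g k) μ)
    (h0 : ∀ k, 0 ≤ᵐ[μ] g k)
    (hmono : ∀ k, g k ≤ᵐ[μ] g (k + 1)) (M : ℝ) (hM : ∀ k, ∫ ω, g k ω ∂μ ≤ M) :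
    ∃ F : Ω → ℝ, Integrable F μ ∧ ∀ᵐ ω ∂μ, Tendsto (fun k => g k ω) atTop (𝓝 (F ω)) := by
  have hfatou : ∫⁻ ω, liminf (fun k => ‖g k ω‖ₑ) atTop ∂μ < ⊤ := by
    refine lt_of_le_of_lt (lintegral_liminf_le' fun k => (hint k).1.enorm) ?_
    refine lt_of_le_of_lt (b := ENNReal.ofReal M) ?_ ENNReal.ofReal_lt_top
    refine liminf_le_of_le (by isBoundedDefault) fun c hc => ?_
    obtain ⟨k, hk⟩ := hc.exists
    refine hk.trans ?_
    rw [← ofReal_integral_norm_eq_lintegral_enorm (hint k)]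
    refine ENNReal.ofReal_le_ofReal (le_trans (le_of_eq ?_) (hM k))
    refine integral_congr_ae ?_
    filter_upwards [h0 k] with ω hω using by simpa using hω
  have hlim : ∀ᵐ ω ∂μ, Tendsto (fun k => g k ω) atTop (𝓝 (⨆ k, g k ω)) := by
    filter_upwards [ae_all_iff.2 h0, ae_all_iff.2 hmono,
      ae_lt_top (Measurable.liminf fun k => (hmeas k).enorm) hfatou.ne] with ω hω0 hωm hωt
    have hm : Monotone fun k => g k ω := monotone_nat_of_le_succ hωm
    refine tendsto_atTop_ciSup hm ?_
    obtain ⟨c, hc, hct⟩ := exists_between hωt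
    refine ⟨c.toReal, ?_⟩
    rintro _ ⟨k, rfl⟩
    obtain ⟨n, hn, hkn⟩ := ((frequently_lt_of_liminf_lt (by isBoundedDefault) hc).and_eventually
      (eventually_ge_atTop k)).exists
    refine (hm hkn).trans ((le_abs_self _).trans ?_)
    rw [← Real.norm_eq_abs, ← toReal_enorm]
    exact ENNReal.toReal_mono hct.ne hn.le
  refine ⟨_, ⟨aestronglyMeasurable_of_tendsto_ae _ (fun k => (hint k).1) hlim, ?_⟩, hlim⟩
  refine lt_of_le_of_lt (le_of_eq (lintegral_congr_ae ?_)) hfatou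
  filter_upwards [hlim] with ω hω using hω.enorm.liminf_eq.symm

theorem sum_measureReal_lt_le {Ω : Type*} [MeasurableSpace Ω] {μ : Measure Ω}
    [IsProbabilityMeasure μ] {f : Ω → ℝ} (hf : Measurable f) (hint : Integrable f μ)
    (h0 : ∀ ω, 0 ≤ f ω) (L : ℕ) :
    ∑ k ∈ Finset.range L, μ.real {ω | (k : ℝ) < f ω} ≤ ∫ ω, f ω ∂μ + 1 := by
  have hs : ∀ k : ℕ, MeasurableSet {ω | (k : ℝ) < f ω} := fun k =>
    measurableSet_lt measurable_const hf
  have hi : ∀ k : ℕ, Integrable ({ω | (k : ℝ) < f ω}.indicator (1 : Ω → ℝ)) μ := fun k =>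
    (integrable_const (1 : ℝ)).indicator (hs k)
  simp_rw [← fun k => integral_indicator_one (μ := μ) (hs k)]
  rw [← integral_finsetSum _ fun k _ => hi k]
  calc _ ≤ ∫ ω, (f ω + 1) ∂μ := by
        refine integral_mono (integrable_finsetSum _ fun k _ => hi k)
          (hint.add (integrable_const 1)) fun ω => ?_
        simp only [Set.indicator_apply, Pi.one_apply, Set.mem_ofPred_eq]
        rw [← Finset.sum_filter, Finset.sum_const, nsmul_one]
        have : (Finset.range L).filter (fun k : ℕ => (k : ℝ) < f ω) ⊆ Finset.range ⌈f ω⌉₊ :=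
          fun k hk => by
            rw [Finset.mem_range]
            exact Nat.lt_ceil.2 (Finset.mem_filter.1 hk).2
        have h1 := Finset.card_le_card this
        rw [Finset.card_range] at h1
        exact (Nat.cast_le.2 h1).trans (Nat.ceil_lt_add_one (h0 ω)).le
    _ = _ := by rw [integral_add hint (integrable_const 1)]; simp

theorem coeFn_sum_range {Ω : Type*} [MeasurableSpace Ω] {μ : Measure Ω} (x : ℕ → Lp ℝ 2 μ)
    (K : ℕ) : ∀ᵐ ω ∂μ, (∑ k ∈ Finset.range K, x k : Lp ℝ 2 μ) ω = ∑ k ∈ Finset.range K, x k ω := by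
  induction K with
  | zero =>
    filter_upwards [Lp.coeFn_zero ℝ 2 μ] with ω hω
    simpa only [Finset.range_zero, Finset.sum_empty, Pi.zero_apply] using hω
  | succ K ih =>
    rw [Finset.sum_range_succ]
    filter_upwards [ih, Lp.coeFn_add (∑ k ∈ Finset.range K, x k) (x K)] with ω h1 h2
    rw [h2, Pi.add_apply, h1, Finset.sum_range_succ]

theorem komlos_of_nonneg {Ω : Type*} [MeasurableSpace Ω] {μ : Measure Ω}
    [IsProbabilityMeasure μ] (f : ℕ → Ω → ℝ) (hmeas : ∀ n, Measurable (f n))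
    (hint : ∀ n, Integrable (f n) μ) (h0 : ∀ n ω, 0 ≤ f n ω) (M : ℝ)
    (hM : ∀ n, ∫ ω, f n ω ∂μ ≤ M) :
    ∃ φ : ℕ → ℕ, StrictMono φ ∧ ∃ F : Ω → ℝ, Integrable F μ ∧
      ∀ ψ : ℕ → ℕ, StrictMono ψ → ∀ᵐ ω ∂μ,
        Tendsto (fun K : ℕ => (K : ℝ)⁻¹ * ∑ k ∈ Finset.range K, f (φ (ψ k)) ω) atTop
          (𝓝 (F ω)) := by
  have hT : ∀ k n : ℕ, MemLp (truncation (f n) k) 2 μ := fun k n =>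
    (hmeas n).aestronglyMeasurable.memLp_truncation
  let u : ℕ → ℕ → Lp ℝ 2 μ := fun k n => (hT k n).toLp
  have hu : ∀ k n, u k n =ᵐ[μ] truncation (f n) k := fun k n => (hT k n).coeFn_toLp
  have hubound : ∀ k n, ‖u k n‖ ≤ k := fun k n => by
    refine (Lp.norm_le_of_ae_bound (C := k) k.cast_nonneg ?_).trans (by simp [measureUnivNNReal])
    filter_upwards [hu k n] with ω hω
    rw [hω]
    exact (abs_truncation_le_bound _ _ _).trans (by simp)
  have hunorm : ∀ k n, ‖u k n‖ ^ 2 = ∫ ω, (truncation (f n) k ^ 2) ω ∂μ := fun k n => by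
    rw [← real_inner_self_eq_norm_sq, L2.inner_def]
    refine integral_congr_ae ?_
    filter_upwards [hu k n] with ω hω
    simp [hω, sq]
  obtain ⟨φ, A, B, g, hφ, hweak, hA, hB, hsel⟩ := exists_subseq_almost_orthogonal u
    (fun k => k) hubound (fun k n => μ.real {ω | (k : ℝ) < f n ω})
    (fun k n => by rw [abs_of_nonneg measureReal_nonneg]; exact measureReal_le_one)
  have hA0 : ∀ k, 0 ≤ A k := fun k => ge_of_tendsto' (hA k) fun n => by positivity
  have hB0 : ∀ k, 0 ≤ B k := fun k => ge_of_tendsto' (hB k) fun n => measureReal_nonneg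
  have hBsum : Summable B := summable_of_sum_range_le hB0 (c := M + 1) fun L =>
    le_of_tendsto' (tendsto_finsetSum _ fun k _ => hB k) fun n =>
      (sum_measureReal_lt_le (hmeas _) (hint _) (h0 _) L).trans (by linarith [hM (φ n)])
  have hAsum : Summable fun k : ℕ => A k / (k : ℝ) ^ 2 := by
    refine summable_of_sum_range_le (c := 2 * M)
      (fun k => div_nonneg (hA0 k) (by positivity)) fun L =>
      le_of_tendsto' (tendsto_finsetSum _ fun k _ => (hA k).div_const _) fun n => ?_
    let : MeasureSpace Ω := ⟨μ⟩
    refine (le_of_eq ?_).trans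
      ((sum_variance_truncation_le (hint (φ n)) (h0 (φ n)) L).trans
        (mul_le_mul_of_nonneg_left (hM (φ n)) zero_le_two))
    refine Finset.sum_congr rfl fun k _ => ?_
    rw [hunorm, div_eq_inv_mul]
    rfl
  have hset : ∀ k : ℕ, ∀ s : Set Ω, MeasurableSet s →
      Tendsto (fun n => ∫ ω in s, truncation (f (φ n)) k ω ∂μ) atTop
        (𝓝 (∫ ω in s, g k ω ∂μ)) := fun k s hs => by
    have := hweak k (indicatorConstLp 2 hs (measure_ne_top μ s) (1 : ℝ))
    simp_rw [real_inner_comm (indicatorConstLp 2 hs (measure_ne_top μ s) (1 : ℝ)),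
      L2.inner_indicatorConstLp_one] at this
    refine this.congr fun n => integral_congr_ae (ae_restrict_of_ae (hu k (φ n)))
  have hgint : ∀ k, Integrable (g k) μ := fun k => (Lp.memLp (g k)).integrable one_le_two
  have hTint : ∀ k n : ℕ, Integrable (truncation (f n) k) μ := fun k n =>
    (hT k n).integrable one_le_two
  have hg0 : ∀ k, 0 ≤ᵐ[μ] g k := fun k =>
    ae_nonneg_of_forall_setIntegral_nonneg (hgint k) fun s hs _ =>
      ge_of_tendsto' (hset k s hs) fun n =>
        integral_nonneg fun ω => truncation_nonneg _ (h0 _ ω)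
  have hgmono : ∀ k, g k ≤ᵐ[μ] g (k + 1) := fun k =>
    ae_le_of_forall_setIntegral_le (hgint k) (hgint (k + 1)) fun s hs _ =>
      le_of_tendsto_of_tendsto' (hset k s hs) (hset (k + 1) s hs) fun n =>
        integral_mono (hTint _ _).integrableOn (hTint _ _).integrableOn fun ω => by
          rw [truncation_eq_of_nonneg (h0 _), truncation_eq_of_nonneg (h0 _)]
          simp only [Function.comp_apply, Set.indicator_apply, Set.mem_Ioc, id, Nat.cast_add,
            Nat.cast_one]
          have := h0 (φ n) ω
          split_ifs <;> grind
  have hgM : ∀ k, ∫ ω, g k ω ∂μ ≤ M := fun k => by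
    have := hset k _ MeasurableSet.univ
    simp_rw [setIntegral_univ] at this
    refine le_of_tendsto' this fun n => ?_
    exact (integral_truncation_le_integral_of_nonneg (hint _) (h0 _)).trans (hM _)
  obtain ⟨F, hF, hgF⟩ := exists_integrable_limit_of_monotone (fun k => g k)
    (fun k => (Lp.stronglyMeasurable (g k)).measurable) hgint hg0 hgmono M hgM
  refine ⟨φ, hφ, F, hF, fun ψ hψ => ?_⟩
  set n : ℕ → ℕ := fun k => φ (ψ k) with hn
  let x : ℕ → Lp ℝ 2 μ := fun k => u k (n k) - g k
  have hx : ∀ᵐ ω ∂μ, ∀ k, x k ω = truncation (f (n k)) k ω - g k ω := ae_all_iff.2 fun k => by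
    filter_upwards [Lp.coeFn_sub (u k (n k)) (g k), hu k (n k)] with ω h1 h2
    change (u k (n k) - g k : Lp ℝ 2 μ) ω = _
    rw [h1, Pi.sub_apply, h2]
  have hx0 : x 0 = 0 := by
    have hu0 : ∀ n, u 0 n = 0 := fun n => norm_le_zero_iff.1 (by simpa using hubound 0 n)
    have hg0 : g 0 = 0 := by
      have := hweak 0 (g 0)
      simp only [hu0, inner_zero_left] at this
      exact inner_self_eq_zero.1 (tendsto_nhds_unique this tendsto_const_nhds)
    simp [x, hu0, hg0]
  let W : ℕ → ℝ := fun k => if k = 0 then 0 else A k + 3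
  have hW : ∀ k, ‖x k‖ ^ 2 + 2 * ∑ j ∈ Finset.range k, ⟪x j, x k⟫_ℝ ≤ W k := fun k => by
    rcases Nat.eq_zero_or_pos k with rfl | hk
    · simp [hx0, W]
    · obtain ⟨h1, -, h3⟩ := hsel ψ hψ k
      have h4 : ∑ j ∈ Finset.range k, ⟪x j, x k⟫_ℝ ≤ 1 := by
        refine (Finset.sum_le_card_nsmul _ _ _ fun j hj => h3 j (Finset.mem_range.1 hj)).trans ?_
        rw [Finset.card_range, nsmul_eq_mul, mul_one_div, div_le_one (by positivity)]
        linarith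
      simp only [W, hk.ne', if_false]
      linarith
  have hWsum : Summable fun k : ℕ => W k / (k : ℝ) ^ 2 := by
    have := hAsum.add ((Real.summable_one_div_nat_pow.2 one_lt_two).mul_left 3)
    refine this.congr fun k => ?_
    rcases Nat.eq_zero_or_pos k with rfl | hk
    · simp
    · simp only [W, hk.ne', if_false]
      ring
  have hgeom : ∀ c : ℝ, 1 < c → ∀ᵐ ω ∂μ, Tendsto (fun i : ℕ => (⌊c ^ i⌋₊ : ℝ)⁻¹ *
      ∑ k ∈ Finset.range ⌊c ^ i⌋₊, (truncation (f (n k)) k ω - g k ω)) atTop (𝓝 0) :=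
    fun c hc => by
    have h1 := ae_tendsto_zero_of_summable_norm_sq _ (summable_norm_sq_average_floor_pow x W
      (by simp [W]) (fun k => by simp only [W]; split_ifs <;> linarith [hA0 k]) hWsum
      (norm_sum_sq_le x W hW) hc)
    have h2 : ∀ᵐ ω ∂μ, ∀ K : ℕ, ((K : ℝ)⁻¹ • ∑ k ∈ Finset.range K, x k : Lp ℝ 2 μ) ω =
        (K : ℝ)⁻¹ * ∑ k ∈ Finset.range K, x k ω := ae_all_iff.2 fun K => by
      filter_upwards [Lp.coeFn_smul (K : ℝ)⁻¹ (∑ k ∈ Finset.range K, x k),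
        coeFn_sum_range x K] with ω h1 h2
      rw [h1, Pi.smul_apply, smul_eq_mul, h2]
    filter_upwards [h1, h2, hx] with ω h1 h2 h3
    refine h1.congr fun i => ?_
    rw [h2]
    simp_rw [h3]
  have htail : ∀ᵐ ω ∂μ, ∀ᶠ k : ℕ in atTop, ω ∉ {ω | (k : ℝ) < f (n k) ω} := by
    refine ae_eventually_notMem ?_
    have hs : Summable fun k : ℕ => μ.real {ω | (k : ℝ) < f (n k) ω} :=
      Summable.of_nonneg_of_le (fun _ => measureReal_nonneg) (fun k => (hsel ψ hψ k).2.1)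
        (hBsum.add summable_geometric_two)
    have := hs.tsum_ofReal_ne_top
    simp_rw [ofReal_measureReal (measure_ne_top μ _)] at this
    exact this
  have hcseq : ∀ᵐ ω ∂μ, ∀ m : ℕ, Tendsto (fun i : ℕ => (⌊(1 + 1 / ((m : ℝ) + 1)) ^ i⌋₊ : ℝ)⁻¹ *
      ∑ k ∈ Finset.range ⌊(1 + 1 / ((m : ℝ) + 1)) ^ i⌋₊,
        (truncation (f (n k)) k ω - g k ω)) atTop (𝓝 0) :=
    ae_all_iff.2 fun m => hgeom _ (lt_add_of_pos_right _ (by positivity))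
  filter_upwards [hgF, htail, hcseq] with ω hgω htω hcω
  have htrunc : Tendsto (fun K : ℕ => (∑ k ∈ Finset.range K, truncation (f (n k)) k ω) / K)
      atTop (𝓝 (F ω)) := by
    refine tendsto_div_of_monotone_of_tendsto_div_floor_pow _ _
      (monotone_nat_of_le_succ fun K => ?_) (fun m : ℕ => 1 + 1 / ((m : ℝ) + 1))
      (fun m => lt_add_of_pos_right _ (by positivity))
      (by simpa using tendsto_one_div_add_atTop_nhds_zero_nat.const_add (1 : ℝ)) fun m => ?_
    · rw [Finset.sum_range_succ]
      exact le_add_of_nonneg_right (truncation_nonneg _ (h0 _ ω))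
    · have hfloor : Tendsto (fun i : ℕ => ⌊(1 + 1 / ((m : ℝ) + 1)) ^ i⌋₊) atTop atTop :=
        tendsto_nat_floor_atTop.comp
          (tendsto_pow_atTop_atTop_of_one_lt (lt_add_of_pos_right _ (by positivity)))
      have := (hcω m).add (hgω.cesaro.comp hfloor)
      rw [zero_add] at this
      refine this.congr fun i => ?_
      simp only [Function.comp_apply]
      rw [← mul_add, ← Finset.sum_add_distrib, inv_mul_eq_div]
      simp
  have hdiff : Tendsto (fun k : ℕ => f (n k) ω - truncation (f (n k)) k ω) atTop (𝓝 0) := by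
    refine tendsto_const_nhds.congr' ?_
    filter_upwards [htω] with k hk
    have hk' : f (n k) ω ≤ k := not_lt.1 hk
    rw [truncation_eq_of_nonneg (h0 _)]
    by_cases hpos : 0 < f (n k) ω
    · simp [Set.indicator_of_mem (show f (n k) ω ∈ Set.Ioc (0 : ℝ) k from ⟨hpos, hk'⟩)]
    · simp [Set.indicator, le_antisymm (not_lt.1 hpos) (h0 _ ω)]
  have := hdiff.cesaro.add htrunc
  rw [zero_add] at this
  refine this.congr fun K => ?_
  rw [div_eq_inv_mul, ← mul_add, ← Finset.sum_add_distrib]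
  simp [hn]

theorem komlos {Ω : Type*} [MeasurableSpace Ω] {μ : Measure Ω} [IsProbabilityMeasure μ]
    (f : ℕ → Ω → ℝ) (hmeas : ∀ n, Measurable (f n)) (hint : ∀ n, Integrable (f n) μ) (M : ℝ)
    (hM : ∀ n, ∫ ω, |f n ω| ∂μ ≤ M) :
    ∃ φ : ℕ → ℕ, StrictMono φ ∧ ∃ F : Ω → ℝ, Integrable F μ ∧
      ∀ ψ : ℕ → ℕ, StrictMono ψ → ∀ᵐ ω ∂μ,
        Tendsto (fun K : ℕ => (K : ℝ)⁻¹ * ∑ k ∈ Finset.range K, f (φ (ψ k)) ω) atTop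
          (𝓝 (F ω)) := by
  obtain ⟨φ₁, hφ₁, F₁, hF₁, h₁⟩ := komlos_of_nonneg (fun n ω => max (f n ω) 0)
    (fun n => (hmeas n).max measurable_const) (fun n => (hint n).pos_part)
    (fun n ω => le_max_right _ _) M fun n =>
      (integral_mono (hint n).pos_part (hint n).abs fun ω =>
        max_le (le_abs_self _) (abs_nonneg _)).trans (hM n)
  obtain ⟨φ₂, hφ₂, F₂, hF₂, h₂⟩ := komlos_of_nonneg (fun n ω => max (-f (φ₁ n) ω) 0)
    (fun n => (hmeas _).neg.max measurable_const) (fun n => (hint _).neg_part)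
    (fun n ω => le_max_right _ _) M fun n =>
      (integral_mono (hint _).neg_part (hint _).abs fun ω =>
        max_le (neg_le_abs _) (abs_nonneg _)).trans (hM (φ₁ n))
  refine ⟨φ₁ ∘ φ₂, hφ₁.comp hφ₂, fun ω => F₁ ω - F₂ ω, hF₁.sub hF₂, fun ψ hψ => ?_⟩
  filter_upwards [h₁ (φ₂ ∘ ψ) (hφ₂.comp hψ), h₂ ψ hψ] with ω hω₁ hω₂
  refine (hω₁.sub hω₂).congr fun K => ?_
  rw [← mul_sub, ← Finset.sum_sub_distrib]
  congr 1
  refine Finset.sum_congr rfl fun k _ => ?_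
  simp

theorem exists_common_subseq {ι : Type*} (Q : ι → (ℕ → ℕ) → Prop)
    (hsub : ∀ i (φ ψ : ℕ → ℕ), StrictMono ψ → Q i φ → Q i (φ ∘ ψ))
    (hex : ∀ i (φ : ℕ → ℕ), StrictMono φ → ∃ ψ : ℕ → ℕ, StrictMono ψ ∧ Q i (φ ∘ ψ)) (s : Finset ι) :
    ∃ φ : ℕ → ℕ, StrictMono φ ∧ ∀ i ∈ s, Q i φ := by
  induction s using Finset.cons_induction with
  | empty => exact ⟨id, strictMono_id, by simp⟩
  | cons i s hi ih =>
    obtain ⟨φ, hφ, hQ⟩ := ih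
    obtain ⟨ψ, hψ, hQi⟩ := hex i φ hφ
    exact ⟨φ ∘ ψ, hφ.comp hψ,
      (Finset.forall_mem_cons hi _).2 ⟨hQi, fun j hj => hsub j φ ψ hψ (hQ j hj)⟩⟩

end Komlos

/-- Corollary A.6 (multidimensional Komlós theorem): Cesàro means of a subsequence
converge componentwise a.s. (Statement 18). -/
theorem multidimensional_komlos
    {Ω : Type*} [MeasurableSpace Ω] (ℙ : Measure Ω) [IsProbabilityMeasure ℙ]
    {N : ℕ} (P : Fin N → Measure Ω)
    (hPprob : ∀ j, IsProbabilityMeasure (P j))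
    (hPac : ∀ j, P j ≪ ℙ)
    (Y : ℕ → Ω → Fin N → ℝ)
    (hmeas : ∀ n, Measurable (Y n))
    (hint : ∀ n j, Integrable (fun ω => Y n ω j) (P j))
    (hbdd : ∃ M : ℝ, ∀ n, (∑ j, ∫ ω, |Y n ω j| ∂(P j)) ≤ M) :
    ∃ φ : ℕ → ℕ, StrictMono φ ∧
      ∃ Yhat : Ω → Fin N → ℝ,
        (∀ j, Integrable (fun ω => Yhat ω j) (P j)) ∧
        ∀ ψ : ℕ → ℕ, StrictMono ψ → ∀ j : Fin N,
          ∀ᵐ ω ∂(P j),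
            Tendsto
              (fun K : ℕ => (1 / (K : ℝ)) * ∑ k ∈ Finset.range K, Y (φ (ψ k)) ω j)
              atTop (nhds (Yhat ω j)) := by
  obtain ⟨M, hM⟩ := hbdd
  have hMj : ∀ n j, ∫ ω, |Y n ω j| ∂(P j) ≤ M := fun n j =>
    (Finset.single_le_sum (f := fun j => ∫ ω, |Y n ω j| ∂(P j))
      (fun i _ => integral_nonneg fun ω => abs_nonneg _) (Finset.mem_univ j)).trans (hM n)
  obtain ⟨φ, hφ, hQ⟩ := exists_common_subseq
    (fun j φ => ∃ F : Ω → ℝ, Integrable F (P j) ∧ ∀ ψ : ℕ → ℕ, StrictMono ψ → ∀ᵐ ω ∂(P j),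
      Tendsto (fun K : ℕ => (K : ℝ)⁻¹ * ∑ k ∈ Finset.range K, Y (φ (ψ k)) ω j) atTop
        (nhds (F ω)))
    (fun j φ ψ hψ ⟨F, hF, h⟩ => ⟨F, hF, fun χ hχ => h (ψ ∘ χ) (hψ.comp hχ)⟩)
    (fun j φ _ => komlos (fun n ω => Y (φ n) ω j) (fun n => (measurable_pi_apply j).comp (hmeas _))
      (fun n => hint _ j) M fun n => hMj _ j)
    Finset.univ
  choose F hF hlim using fun j => hQ j (Finset.mem_univ j)
  refine ⟨φ, hφ, fun ω j => F j ω, hF, fun ψ hψ j => ?_⟩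
  simpa only [one_div] using hlim j ψ hψ

end MSORTE
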